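/- (Invariance of deconfounded CKA to isotropic scaling.) Let n ≥ 2, let K⁰ ∈ ℝ^{n×n} be a nonzero matrix, and let X₁ ∈ ℝ^{n×p₁}, X₂ ∈ ℝ^{n×p₂}. Define A₁ = d(Gram(X₁)) and A₂ = d(Gram(X₂)), where d(K) = K − α̂(K)·K⁰, and assume tr((A₁)₊) ≠ 0, tr((A₂)₊) ≠ 0, HSIC(Ã₁, Ã₁) > 0 and HSIC(Ã₂, Ã₂) > 0. Then for any nonzero scalars γ, θ ∈ ℝ, the deconfounded CKA is invariant: CKA((d(Gram(γX₁)))~, (d(Gram(θX₂)))~) = CKA(Ã₁, Ã₂). -/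

import Mathlib

open Matrix BigOperators

noncomputable section

/-- Linear-kernel representational similarity (Gram) matrix: `Gram(X) = X Xᵀ`. -/
def gram {n p : ℕ} (X : Matrix (Fin n) (Fin p) ℝ) : Matrix (Fin n) (Fin n) ℝ := X * Xᵀ

/-- Squared Euclidean distance matrix: `D(X)_{ij} = ‖xᵢ - xⱼ‖²` for rows `xᵢ` of `X`. -/
def sqDist {n p : ℕ} (X : Matrix (Fin n) (Fin p) ℝ) : Matrix (Fin n) (Fin n) ℝ :=
  Matrix.of fun i j => ∑ k, (X i k - X j k) ^ 2

/-- Frobenius inner product of two matrices. -/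
def frob {n : ℕ} (A B : Matrix (Fin n) (Fin n) ℝ) : ℝ := ∑ i, ∑ j, A i j * B i j

/-- Frobenius norm. -/
def frobNorm {n : ℕ} (A : Matrix (Fin n) (Fin n) ℝ) : ℝ := Real.sqrt (frob A A)

/-- Regression coefficient `α̂(K) = ⟨K⁰, K⟩_F / ‖K⁰‖_F²`. -/
def alphaHat {n : ℕ} (K0 K : Matrix (Fin n) (Fin n) ℝ) : ℝ := frob K0 K / frob K0 K0

/-- Deconfounded similarity matrix `dK = K - α̂(K) • K⁰`. -/
def dcf {n : ℕ} (K0 K : Matrix (Fin n) (Fin n) ℝ) : Matrix (Fin n) (Fin n) ℝ :=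
  K - alphaHat K0 K • K0

/-- Centering matrix `H = Iₙ - (1/n) 𝟙𝟙ᵀ`. -/
def centering (n : ℕ) : Matrix (Fin n) (Fin n) ℝ :=
  1 - (n : ℝ)⁻¹ • Matrix.of (fun _ _ => (1 : ℝ))

/-- Empirical HSIC estimator `HSIC(K, L) = tr(K H L H)/(n-1)²`. -/
def hsic {n : ℕ} (K L : Matrix (Fin n) (Fin n) ℝ) : ℝ :=
  (K * centering n * L * centering n).trace / ((n : ℝ) - 1) ^ 2

/-- Centered kernel alignment `CKA(K, L) = HSIC(K, L)/√(HSIC(K,K)·HSIC(L,L))`. -/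
def cka {n : ℕ} (K L : Matrix (Fin n) (Fin n) ℝ) : ℝ :=
  hsic K L / Real.sqrt (hsic K K * hsic L L)

/-- Positive part `A₊ = Q Λ₊ Qᵀ` of a real symmetric matrix. -/
def posPart {n : ℕ} {A : Matrix (Fin n) (Fin n) ℝ} (hA : A.IsHermitian) :
    Matrix (Fin n) (Fin n) ℝ :=
  (hA.eigenvectorUnitary : Matrix (Fin n) (Fin n) ℝ) *
    Matrix.diagonal (fun i => max 0 (hA.eigenvalues i)) *
    star (hA.eigenvectorUnitary : Matrix (Fin n) (Fin n) ℝ)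

/-- Negative part `A₋ = Q Λ₋ Qᵀ` of a real symmetric matrix. -/
def negPart {n : ℕ} {A : Matrix (Fin n) (Fin n) ℝ} (hA : A.IsHermitian) :
    Matrix (Fin n) (Fin n) ℝ :=
  (hA.eigenvectorUnitary : Matrix (Fin n) (Fin n) ℝ) *
    Matrix.diagonal (fun i => max 0 (-(hA.eigenvalues i))) *
    star (hA.eigenvectorUnitary : Matrix (Fin n) (Fin n) ℝ)

/-- PSD approximation `Ã = ρ² A₊` with `ρ = |tr A| / |tr A₊|`. -/
def psdApprox {n : ℕ} {A : Matrix (Fin n) (Fin n) ℝ} (hA : A.IsHermitian) :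
    Matrix (Fin n) (Fin n) ℝ :=
  (|A.trace| / |(posPart hA).trace|) ^ 2 • posPart hA

lemma gram_smul {n p : ℕ} (c : ℝ) (X : Matrix (Fin n) (Fin p) ℝ) :
    gram (c • X) = (c ^ 2) • gram X := by
  simp [_root_.gram, smul_smul, pow_two]

lemma dcf_smul {n : ℕ} (c : ℝ) (K0 K : Matrix (Fin n) (Fin n) ℝ) :
    dcf K0 (c • K) = c • dcf K0 K := by
  have h : frob K0 (c • K) = c * frob K0 K := by
    simp only [frob, Finset.mul_sum, Matrix.smul_apply, smul_eq_mul]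
    refine Finset.sum_congr rfl fun i _ => Finset.sum_congr rfl fun j _ => by ring
  simp only [dcf, alphaHat, h, smul_sub, smul_smul, mul_div_assoc]

lemma posPart_eq_cfc {n : ℕ} {A : Matrix (Fin n) (Fin n) ℝ} (hA : A.IsHermitian) :
    posPart hA = cfc (fun x : ℝ => max 0 x) A := by
  rw [hA.cfc_eq, Matrix.IsHermitian.cfc]
  simp [_root_.posPart, Unitary.conjStarAlgAut_apply, Function.comp_def]

lemma posPart_smul {n : ℕ} {A B : Matrix (Fin n) (Fin n) ℝ} (hA : A.IsHermitian)
    (hB : B.IsHermitian) {c : ℝ} (hc : 0 < c) (h : B = c • A) :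
    posPart hB = c • posPart hA := by
  have hA' : IsSelfAdjoint A := hA
  rw [posPart_eq_cfc, posPart_eq_cfc, h, ← cfc_comp_smul c (fun x : ℝ => max 0 x) A,
    ← cfc_smul c (fun x : ℝ => max 0 x) A]
  congr 1
  funext x
  simp [mul_max_of_nonneg _ _ hc.le]

lemma psdApprox_smul {n : ℕ} {A B : Matrix (Fin n) (Fin n) ℝ} (hA : A.IsHermitian)
    (hB : B.IsHermitian) {c : ℝ} (hc : 0 < c) (h : B = c • A) :
    psdApprox hB = c • psdApprox hA := by
  have ht : B.trace = c * A.trace := by rw [h]; simp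
  rw [psdApprox, psdApprox, posPart_smul hA hB hc h, ht, Matrix.trace_smul, smul_eq_mul,
    abs_mul, abs_mul, mul_div_mul_left _ _ (abs_pos.2 hc.ne').ne', smul_comm]

lemma hsic_smul {n : ℕ} (a b : ℝ) (K L : Matrix (Fin n) (Fin n) ℝ) :
    hsic (a • K) (b • L) = a * b * hsic K L := by
  simp only [hsic, Matrix.smul_mul, Matrix.mul_smul, Matrix.trace_smul, smul_eq_mul]
  ring

lemma cka_smul {n : ℕ} {a b : ℝ} (ha : 0 < a) (hb : 0 < b) (K L : Matrix (Fin n) (Fin n) ℝ) :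
    cka (a • K) (b • L) = cka K L := by
  have hab : 0 < a * b := mul_pos ha hb
  rw [cka, cka, hsic_smul, hsic_smul, hsic_smul,
    show a * a * hsic K K * (b * b * hsic L L) = (a * b) ^ 2 * (hsic K K * hsic L L) by ring,
    Real.sqrt_mul (sq_nonneg _), Real.sqrt_sq hab.le, mul_div_mul_left _ _ hab.ne']

/-- invariance of deconfounded CKA to isotropic scaling. -/
theorem dcka_isotropic_scaling_invariant {n p₁ p₂ : ℕ} (hn : 2 ≤ n)
    (K0 : Matrix (Fin n) (Fin n) ℝ) (hK0 : K0 ≠ 0)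
    (X₁ : Matrix (Fin n) (Fin p₁) ℝ) (X₂ : Matrix (Fin n) (Fin p₂) ℝ)
    (γ θ : ℝ) (hγ : γ ≠ 0) (hθ : θ ≠ 0)
    (hA₁ : (dcf K0 (gram X₁)).IsHermitian) (hA₂ : (dcf K0 (gram X₂)).IsHermitian)
    (hA₁' : (dcf K0 (gram (γ • X₁))).IsHermitian)
    (hA₂' : (dcf K0 (gram (θ • X₂))).IsHermitian)
    (ht₁ : (posPart hA₁).trace ≠ 0) (ht₂ : (posPart hA₂).trace ≠ 0)
    (hH₁ : 0 < hsic (psdApprox hA₁) (psdApprox hA₁))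
    (hH₂ : 0 < hsic (psdApprox hA₂) (psdApprox hA₂)) :
    cka (psdApprox hA₁') (psdApprox hA₂') = cka (psdApprox hA₁) (psdApprox hA₂) := by
  have h1 : 0 < γ ^ 2 := by positivity
  have h2 : 0 < θ ^ 2 := by positivity
  rw [psdApprox_smul hA₁ hA₁' h1 (by rw [gram_smul, dcf_smul]),
    psdApprox_smul hA₂ hA₂' h2 (by rw [gram_smul, dcf_smul]), cka_smul h1 h2]
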